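/- (Theorem 3, log-convex upper bound) Let r ≥ 1, let X₁, …, X_r be i.i.d. nonnegative integrable random variables with common tail distribution F̄(x) = P(X > x) which is log-convex on [0,∞), and let 0 = t₁ ≤ t₂ ≤ … ≤ t_r be real numbers (relative task start times). Define S = min₁≤i≤r (Xᵢ + tᵢ) and the computing cost C = Σ₁≤i≤r max(S − tᵢ, 0). Then E[C] ≤ E[X₁]. -/

import Mathlib

open MeasureTheory ProbabilityTheory

/-- A function valued in `[0, 1]` and log-convex on `[0, ∞)` is supermultiplicative there. -/
lemma mul_le_add_of_logConvex {F : ℝ → ℝ} (hF0 : ∀ x, 0 ≤ F x) (hF1 : ∀ x, F x ≤ 1)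
    (hlog : ∀ x ≥ (0:ℝ), ∀ y ≥ (0:ℝ), ∀ θ ∈ Set.Icc (0:ℝ) 1,
      F (θ * x + (1 - θ) * y) ≤ F x ^ θ * F y ^ (1 - θ))
    {x y : ℝ} (hx : 0 ≤ x) (hy : 0 ≤ y) : F x * F y ≤ F (x + y) := by
  rcases (add_nonneg hx hy).eq_or_lt with h | h
  · obtain rfl : x = 0 := by linarith
    simpa using mul_le_of_le_one_left (hF0 y) (hF1 0)
  set θ := x / (x + y) with hθ
  have hθ0 : 0 ≤ θ := by positivity
  have hθ1 : θ ≤ 1 := div_le_one_of_le₀ (by linarith) h.le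
  have hθx : θ * (x + y) = x := div_mul_cancel₀ x h.ne'
  have hFx := hlog (x + y) h.le 0 le_rfl θ ⟨hθ0, hθ1⟩
  have hFy := hlog 0 le_rfl (x + y) h.le θ ⟨hθ0, hθ1⟩
  have ex : θ * (x + y) + (1 - θ) * 0 = x := by linarith
  have ey : θ * 0 + (1 - θ) * (x + y) = y := by linarith
  rw [ex] at hFx
  rw [ey] at hFy
  have hsplit (z : ℝ) : F z ^ θ * F z ^ (1 - θ) = F z := by
    rw [← Real.rpow_add_of_nonneg (hF0 z) hθ0 (by linarith)]
    simp
  calc F x * F y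
      ≤ (F (x + y) ^ θ * F 0 ^ (1 - θ)) * (F 0 ^ θ * F (x + y) ^ (1 - θ)) :=
        mul_le_mul hFx hFy (hF0 y) ((hF0 x).trans hFx)
    _ = (F (x + y) ^ θ * F (x + y) ^ (1 - θ)) * (F 0 ^ θ * F 0 ^ (1 - θ)) := by ring
    _ = F (x + y) * F 0 := by rw [hsplit, hsplit]
    _ ≤ F (x + y) := mul_le_of_le_one_right (hF0 _) (hF1 0)

lemma prod_le_sum_of_supermultiplicative {ι : Type*} {F : ℝ → ℝ} (hF0 : ∀ x, 0 ≤ F x)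
    (hmul : ∀ x y, 0 ≤ x → 0 ≤ y → F x * F y ≤ F (x + y))
    {s : Finset ι} (hs : s.Nonempty) {a : ι → ℝ} (ha : ∀ i ∈ s, 0 ≤ a i) :
    ∏ i ∈ s, F (a i) ≤ F (∑ i ∈ s, a i) := by
  induction hs using Finset.Nonempty.cons_induction with
  | singleton i => simp
  | cons i s his hs ih =>
    rw [Finset.prod_cons, Finset.sum_cons]
    have has : ∀ j ∈ s, 0 ≤ a j := fun j hj => ha j (Finset.mem_cons_of_mem hj)
    exact (mul_le_mul_of_nonneg_left (ih has) (hF0 _)).trans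
      (hmul _ _ (ha i (Finset.mem_cons_self i s)) (Finset.sum_nonneg has))

/-- First-order stochastic dominance implies comparison of means. -/
lemma integral_le_integral_of_tail_le {Ω : Type*} [MeasurableSpace Ω] {μ : Measure Ω}
    {Y Z : Ω → ℝ} (hY : AEMeasurable Y μ) (hY0 : 0 ≤ Y) (hZ0 : 0 ≤ Z)
    (hZ : Integrable Z μ)
    (htail : ∀ u > 0, μ {ω | u < Y ω} ≤ μ {ω | u < Z ω}) :
    ∫ ω, Y ω ∂μ ≤ ∫ ω, Z ω ∂μ := by
  have hZ0' : 0 ≤ᵐ[μ] Z := .of_forall hZ0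
  have hY0' : 0 ≤ᵐ[μ] Y := .of_forall hY0
  rw [integral_eq_lintegral_of_nonneg_ae hY0' hY.aestronglyMeasurable,
    integral_eq_lintegral_of_nonneg_ae hZ0' hZ.aestronglyMeasurable]
  refine ENNReal.toReal_mono ?_ ?_
  · exact ((hasFiniteIntegral_iff_ofReal hZ0').1 hZ.hasFiniteIntegral).ne
  · rw [lintegral_eq_lintegral_meas_lt μ hY0' hY,
      lintegral_eq_lintegral_meas_lt μ hZ0' hZ.aemeasurable]
    exact setLIntegral_mono' measurableSet_Ioi htail

/-- Theorem 3 (log-convex, upper bound): for i.i.d. nonnegative integrable task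
service times `X₁, …, X_r` whose common tail `F̄(x) = P(X > x)` is log-convex on
`[0, ∞)`, relative task start times `0 = t₁ ≤ t₂ ≤ … ≤ t_r`,
`S = min_i (Xᵢ + tᵢ)` and computing cost `C = Σᵢ max(S − tᵢ, 0)`, we have
`E[C] ≤ E[X₁]`. -/
theorem expected_cost_le_EX_of_logConvex_tail
    {Ω : Type*} [MeasurableSpace Ω] (μ : Measure Ω) [IsProbabilityMeasure μ]
    {r : ℕ} (hr : 0 < r)
    (X : Fin r → Ω → ℝ) (hX : ∀ i, Measurable (X i))
    (hindep : iIndepFun (m := fun _ => Real.measurableSpace) X μ)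
    (hident : ∀ i, IdentDistrib (X i) (X ⟨0, hr⟩) μ μ)
    (hnonneg : ∀ i ω, 0 ≤ X i ω)
    (hint : Integrable (X ⟨0, hr⟩) μ)
    (F : ℝ → ℝ) (hF : ∀ x, F x = (μ {ω | X ⟨0, hr⟩ ω > x}).toReal)
    (hlogconvex : ∀ x ≥ (0:ℝ), ∀ y ≥ (0:ℝ), ∀ θ ∈ Set.Icc (0:ℝ) 1,
      F (θ * x + (1 - θ) * y) ≤ F x ^ θ * F y ^ (1 - θ))
    (t : Fin r → ℝ) (ht0 : t ⟨0, hr⟩ = 0) (htmono : Monotone t)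
    (S : Ω → ℝ) (hS : ∀ ω, S ω = ⨅ i, (X i ω + t i))
    (C : Ω → ℝ) (hC : ∀ ω, C ω = ∑ i, max (S ω - t i) 0) :
    ∫ ω, C ω ∂μ ≤ ∫ ω, X ⟨0, hr⟩ ω ∂μ := by
  have : Nonempty (Fin r) := ⟨⟨0, hr⟩⟩
  have hF0 (x : ℝ) : 0 ≤ F x := by rw [hF]; exact ENNReal.toReal_nonneg
  have hF1 (x : ℝ) : F x ≤ 1 := by rw [hF]; exact measureReal_le_one
  have htn (i : Fin r) : 0 ≤ t i := ht0 ▸ htmono (Nat.zero_le _)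
  have hSm : Measurable S := by
    rw [funext hS]
    exact Measurable.iInf fun i => (hX i).add_const _
  have hCm : Measurable C := by
    rw [funext hC]
    fun_prop
  have hC0 : 0 ≤ C := fun ω => by
    rw [hC]
    exact Finset.sum_nonneg fun i _ => le_max_right _ _
  refine integral_le_integral_of_tail_le hCm.aemeasurable hC0 (hnonneg _) hint fun u hu => ?_
  -- `C` is a continuous nondecreasing function of `S`, so `C > u` forces `S > s` for some level `s`
  obtain ⟨s, hs, hsu⟩ : ∃ s, 0 ≤ s ∧ ∑ i, max (s - t i) 0 = u := by
    have hcont : Continuous fun s : ℝ => ∑ i, max (s - t i) 0 := by fun_prop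
    have hzero : ∑ i, max (0 - t i) 0 = 0 :=
      Finset.sum_eq_zero fun i _ => max_eq_right (by linarith [htn i])
    have hle : u ≤ ∑ i, max (u - t i) 0 := by
      have h := Finset.single_le_sum (f := fun i => max (u - t i) 0)
        (fun i _ => le_max_right _ _) (Finset.mem_univ ⟨0, hr⟩)
      simp only [ht0, sub_zero] at h
      exact (le_max_left _ _).trans h
    obtain ⟨s, hs, hsu⟩ := intermediate_value_Icc hu.le hcont.continuousOn
      (show u ∈ Set.Icc _ _ from ⟨hzero.trans_le hu.le, hle⟩)
    exact ⟨s, hs.1, hsu⟩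
  have hsub : {ω | u < C ω} ⊆ ⋂ i ∈ (Finset.univ : Finset (Fin r)), X i ⁻¹' Set.Ioi (s - t i) := by
    intro ω hω
    have hsS : s < S ω := by
      by_contra! h
      refine (show u < C ω from hω).not_ge ?_
      rw [hC, ← hsu]
      gcongr
    simp only [Set.mem_iInter, Set.mem_preimage, Set.mem_Ioi]
    intro i _
    have hi : S ω ≤ X i ω + t i := by
      rw [hS]
      exact ciInf_le (Set.finite_range _).bddBelow i
    linarith
  have htail (i : Fin r) (x : ℝ) : μ (X i ⁻¹' Set.Ioi x) = ENNReal.ofReal (F x) := by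
    rw [(hident i).measure_mem_eq measurableSet_Ioi, hF, ENNReal.ofReal_toReal (measure_ne_top _ _)]
    rfl
  have hprod : ∏ i, F (s - t i) ≤ F u := by
    have hne : (Finset.univ.filter fun i => t i ≤ s).Nonempty :=
      ⟨⟨0, hr⟩, by simpa [ht0] using hs⟩
    calc ∏ i, F (s - t i)
        ≤ ∏ i with t i ≤ s, F (s - t i) :=
          Finset.prod_le_prod_of_subset_of_le_one (Finset.filter_subset _ _)
            (fun i _ => hF0 _) fun i _ _ => hF1 _
      _ ≤ F (∑ i with t i ≤ s, (s - t i)) :=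
          prod_le_sum_of_supermultiplicative hF0
            (fun x y => mul_le_add_of_logConvex hF0 hF1 hlogconvex) hne
            fun i hi => sub_nonneg.2 (Finset.mem_filter.1 hi).2
      _ = F u := by
          rw [← hsu, Finset.sum_filter]
          congr 1
          refine Finset.sum_congr rfl fun i _ => ?_
          split_ifs with h
          · rw [max_eq_left (by linarith)]
          · rw [max_eq_right (by linarith)]
  calc μ {ω | u < C ω}
      ≤ μ (⋂ i ∈ (Finset.univ : Finset (Fin r)), X i ⁻¹' Set.Ioi (s - t i)) := measure_mono hsub
    _ = ∏ i, μ (X i ⁻¹' Set.Ioi (s - t i)) :=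
        hindep.measure_inter_preimage_eq_mul Finset.univ fun _ _ => measurableSet_Ioi
    _ = ENNReal.ofReal (∏ i, F (s - t i)) := by
        simp only [htail, ENNReal.ofReal_prod_of_nonneg fun i _ => hF0 _]
    _ ≤ ENNReal.ofReal (F u) := ENNReal.ofReal_le_ofReal hprod
    _ = μ {ω | u < X ⟨0, hr⟩ ω} := (htail ⟨0, hr⟩ u).symm
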